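/- Let S₁ : M₃(ℝ) → M₃(ℝ) be any map and define σ(X) = S₁(X)·(Cof X)⁻¹ for invertible X. Then for every F with det F ≠ 0, and all ξ, η ∈ ℝ³ with det(F + ξ⊗η) ≠ 0, the identity ⟨S₁(F + ξ⊗η) − S₁(F), ξ⊗η⟩ = ⟨σ(F + ξ⊗η) − σ(F), ξ ⊗ ((Cof F)·η)⟩ holds. -/

import Mathlib

open Matrix

/-- The space of real 3×3 matrices. -/
abbrev M3 : Type := Matrix (Fin 3) (Fin 3) ℝ

/-- The cofactor matrix: the transpose of the adjugate. -/
def Cof (A : M3) : M3 := A.adjugateᵀ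

/-- The Frobenius inner product `⟨A, B⟩ = tr(Aᵀ B)` on 3×3 matrices. -/
def frob (A B : M3) : ℝ := (Aᵀ * B).trace

/-- A rank-one update in the direction `η` does not change the cofactor matrix applied to `η`. -/
theorem Cof_add_vecMulVec_mulVec (F : M3) (ξ η : Fin 3 → ℝ) :
    Cof (F + vecMulVec ξ η) *ᵥ η = Cof F *ᵥ η := by
  ext i
  fin_cases i <;>
    simp [Cof, adjugate_fin_three, mulVec, dotProduct, Fin.sum_univ_three, vecMulVec_apply] <;>
    ring

theorem isUnit_det_Cof {X : M3} (hX : X.det ≠ 0) : IsUnit (Cof X).det := by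
  simp [Cof, det_transpose, det_adjugate, hX]

theorem frob_vecMulVec (A : M3) (ξ η : Fin 3 → ℝ) :
    frob A (vecMulVec ξ η) = ξ ⬝ᵥ (A *ᵥ η) := by
  rw [frob, mul_vecMulVec, trace_vecMulVec, mulVec_transpose, dotProduct_mulVec]

/-- For any map `S₁` with associated Cauchy stress
`σ(X) = S₁(X)·(Cof X)⁻¹`, the identity
`⟨S₁(F+ξ⊗η) − S₁(F), ξ⊗η⟩ = ⟨σ(F+ξ⊗η) − σ(F), ξ ⊗ ((Cof F)·η)⟩` holds
whenever `F` and `F + ξ⊗η` are invertible. -/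
theorem piola_cauchy_rank_one_identity
    (S₁ σ : M3 → M3)
    (hσ : ∀ X : M3, X.det ≠ 0 → σ X = S₁ X * (Cof X)⁻¹)
    (F : M3) (hF : F.det ≠ 0) (ξ η : Fin 3 → ℝ)
    (hFr : (F + vecMulVec ξ η).det ≠ 0) :
    frob (S₁ (F + vecMulVec ξ η) - S₁ F) (vecMulVec ξ η)
      = frob (σ (F + vecMulVec ξ η) - σ F) (vecMulVec ξ ((Cof F).mulVec η)) := by
  have hS : ∀ X : M3, X.det ≠ 0 → σ X *ᵥ (Cof X *ᵥ η) = S₁ X *ᵥ η := fun X hX => by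
    rw [hσ X hX, mulVec_mulVec, nonsing_inv_mul_cancel_right _ _ (isUnit_det_Cof hX)]
  rw [frob_vecMulVec, frob_vecMulVec, sub_mulVec, sub_mulVec, ← hS F hF, ← hS _ hFr,
    Cof_add_vecMulVec_mulVec]
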